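/- arXiv:1811.10186 — 2 statements merged into one kernel-verified Lean document; each statement's English description precedes it below -/
import Mathlib

section
/- Okamoto Maya diagrams (case k = p): let M be a canonical Maya diagram with positive part M₊ and let F be a finite set of nonnegative integers with |F| = p such that M Δ F = M ⊕ p. Then no element of M₊ is divisible by p, and there exist natural numbers α₁, …, α_{p−1} ≥ 0 such that M₊ is the disjoint union of the p-Okamoto blocks (l | α_l)_p for l = 1, …, p−1, and F = {0} ∪ {l + α_l·p : 1 ≤ l ≤ p−1}. -/
open Function

/-- A Maya diagram in canonical form: it contains every negative integer,
does not contain `0`, and its nonnegative part is finite. -/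
def IsCanonicalMaya (M : Set ℤ) : Prop :=
  (∀ n : ℤ, n < 0 → n ∈ M) ∧ (0 : ℤ) ∉ M ∧ {n : ℤ | n ∈ M ∧ 0 ≤ n}.Finite

/-- The translate `M ⊕ k = {n + k : n ∈ M}`. -/
def mayaShift (M : Set ℤ) (k : ℤ) : Set ℤ := (fun n => n + k) '' M

/-- A finite set of nonnegative integers, viewed as a set of integers (the flip levels). -/
def finsetFlips (F : Finset ℕ) : Set ℤ := (fun n : ℕ => (n : ℤ)) '' ↑F

/-- The positive part of a canonical Maya diagram, as a set of naturals. -/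
def mayaPos (M : Set ℤ) : Set ℕ := {n : ℕ | (n : ℤ) ∈ M}

/-- The block `(r | s)_k = {r, r + k, …, r + (s-1)k}`. -/
def kBlock (r s k : ℕ) : Set ℕ := {n : ℕ | ∃ i < s, n = r + i * k}

/-- The flip levels are the sites where membership in `M` changes along steps of length `p`. -/
theorem mem_flips_iff {M : Set ℤ} {p : ℕ} {F : Finset ℕ}
    (h : symmDiff M (finsetFlips F) = mayaShift M (p : ℤ)) (n : ℕ) :
    n ∈ F ↔ ¬ ((n : ℤ) ∈ M ↔ (n : ℤ) - p ∈ M) := by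
  have hn : (n : ℤ) ∈ symmDiff M (finsetFlips F) ↔ (n : ℤ) ∈ mayaShift M (p : ℤ) := by rw [h]
  have hflip : (n : ℤ) ∈ finsetFlips F ↔ n ∈ F := by simp [finsetFlips]
  have hshift : (n : ℤ) ∈ mayaShift M (p : ℤ) ↔ (n : ℤ) - p ∈ M := by
    simp [mayaShift, sub_eq_add_neg]
  rw [Set.mem_symmDiff, hflip, hshift] at hn
  tauto

theorem IsCanonicalMaya.exists_add_mul_notMem {M : Set ℤ} (hM : IsCanonicalMaya M) {p : ℕ}
    (hp : 1 ≤ p) (r : ℕ) : ∃ i : ℕ, ((r + i * p : ℕ) : ℤ) ∉ M := by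
  by_contra! h
  have hmem (i : ℕ) : ((r + i * p : ℕ) : ℤ) ∈ {n : ℤ | n ∈ M ∧ 0 ≤ n} :=
    ⟨h i, Int.natCast_nonneg _⟩
  refine Set.infinite_of_injective_forall_mem ?_ hmem hM.2.2
  intro i j hij
  simpa [Nat.ne_of_gt hp] using hij

theorem add_mul_inj_of_lt {p r s a b : ℕ} (hr : r < p) (hs : s < p)
    (h : r + a * p = s + b * p) : r = s ∧ a = b := by
  have hrs : r = s := by
    simpa [Nat.mod_eq_of_lt hr, Nat.mod_eq_of_lt hs] using congrArg (· % p) h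
  subst hrs
  exact ⟨rfl, Nat.eq_of_mul_eq_mul_right (by omega) (Nat.add_left_cancel h)⟩

/-- Each residue class modulo `p` has a single flip, before which it lies in `M` and after which
it lies outside. -/
theorem IsCanonicalMaya.exists_flip_levels {M : Set ℤ} (hM : IsCanonicalMaya M) {p : ℕ}
    (hp : 1 ≤ p) {F : Finset ℕ} (hcard : F.card = p)
    (h : symmDiff M (finsetFlips F) = mayaShift M (p : ℤ)) :
    ∃ a : ℕ → ℕ, (∀ r < p, ∀ i, ((r + i * p : ℕ) : ℤ) ∈ M ↔ i < a r) ∧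
      F = (Finset.range p).image fun r => r + a r * p := by
  classical
  let a : ℕ → ℕ := fun r => Nat.find (hM.exists_add_mul_notMem hp r)
  have ha (r : ℕ) : ((r + a r * p : ℕ) : ℤ) ∉ M := Nat.find_spec (hM.exists_add_mul_notMem hp r)
  have hlt (r i : ℕ) (hi : i < a r) : ((r + i * p : ℕ) : ℤ) ∈ M :=
    not_not.1 (Nat.find_min (hM.exists_add_mul_notMem hp r) hi)
  have hstep (r i : ℕ) : ((r + (i + 1) * p : ℕ) : ℤ) - p = ((r + i * p : ℕ) : ℤ) := by
    push_cast; ring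
  have hF : F = (Finset.range p).image fun r => r + a r * p := by
    symm
    apply Finset.eq_of_subset_of_card_le
    · intro n hn
      obtain ⟨r, hr, rfl⟩ := Finset.mem_image.1 hn
      rw [Finset.mem_range] at hr
      rw [mem_flips_iff h]
      suffices ((r + a r * p : ℕ) : ℤ) - p ∈ M by have := ha r; tauto
      rcases hai : a r with _ | i
      · exact hM.1 _ (by push_cast; omega)
      · rw [hstep]
        exact hlt r i (by omega)
    · rw [hcard, Finset.card_image_of_injOn, Finset.card_range]
      intro r hr s hs hrs
      simp only [Finset.coe_range, Set.mem_Iio] at hr hs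
      exact (add_mul_inj_of_lt hr hs hrs).1
  refine ⟨a, fun r hr i => ⟨fun hi => ?_, hlt r i⟩, hF⟩
  by_contra! hai
  revert hi
  induction i, hai using Nat.le_induction with
  | base => exact ha r
  | succ i hai ih =>
    intro hi
    have hmem : r + (i + 1) * p ∈ F := by
      rw [mem_flips_iff h, hstep]
      tauto
    rw [hF, Finset.mem_image] at hmem
    obtain ⟨s, hs, hsr⟩ := hmem
    obtain ⟨rfl, hi'⟩ := add_mul_inj_of_lt (Finset.mem_range.1 hs) hr hsr
    omega

/-- Okamoto Maya diagrams, case `k = p`: if a canonical Maya diagram `M`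
is sent to `M ⊕ p` by the `p` flips of a finite set `F` of nonnegative integers, then
no element of the positive part of `M` is divisible by `p`, the positive part is the
disjoint union of the `p`-Okamoto blocks `(l | αₗ)_p`, `l = 1, …, p-1`, and
`F = {0} ∪ {l + αₗ·p : 1 ≤ l ≤ p-1}`. -/
theorem okamoto_maya_structure (M : Set ℤ) (hM : IsCanonicalMaya M) (p : ℕ) (hp : 1 ≤ p)
    (F : Finset ℕ) (hcard : F.card = p)
    (hcyc : symmDiff M (finsetFlips F) = mayaShift M (p : ℤ)) :
    (∀ n ∈ mayaPos M, ¬ (p ∣ n)) ∧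
    ∃ α : Fin (p - 1) → ℕ,
      Pairwise (Disjoint on (fun l : Fin (p - 1) => kBlock (l.val + 1) (α l) p)) ∧
      mayaPos M = (⋃ l : Fin (p - 1), kBlock (l.val + 1) (α l) p) ∧
      (↑F : Set ℕ) = {0} ∪ {n : ℕ | ∃ l : Fin (p - 1), n = (l.val + 1) + α l * p} := by
  obtain ⟨a, ha, hF⟩ := hM.exists_flip_levels hp hcard hcyc
  have ha0 : a 0 = 0 := by
    have := (ha 0 hp 0).not.1 (by simpa using hM.2.1)
    omega
  have hdvd : ∀ n ∈ mayaPos M, ¬ (p ∣ n) := by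
    rintro _ hn ⟨i, rfl⟩
    have := (ha 0 hp i).1 (by simpa [mayaPos, mul_comm] using hn)
    omega
  refine ⟨hdvd, fun l => a (l.val + 1), ?_, ?_, ?_⟩
  · intro l m hlm
    refine Set.disjoint_left.2 ?_
    rintro _ ⟨i, _, rfl⟩ ⟨j, _, hij⟩
    have := (add_mul_inj_of_lt (by omega) (by omega) hij).1
    exact hlm (Fin.ext (by omega))
  · ext n
    simp only [Set.mem_iUnion]
    constructor
    · intro hn
      have hmod : n % p ≠ 0 := fun h0 => hdvd n hn (Nat.dvd_of_mod_eq_zero h0)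
      have hmodlt := Nat.mod_lt n hp
      have hdecomp : n = n % p + n / p * p := by rw [mul_comm]; exact (Nat.mod_add_div n p).symm
      refine ⟨⟨n % p - 1, by omega⟩, n / p, ?_, ?_⟩
      · rw [Nat.sub_add_cancel (by omega), ← ha _ hmodlt, ← hdecomp]
        exact hn
      · rw [Nat.sub_add_cancel (by omega)]
        exact hdecomp
    · rintro ⟨l, i, hi, rfl⟩
      exact (ha _ (by omega) i).2 hi
  · ext n
    simp only [hF, Finset.coe_image, Finset.coe_range, Set.mem_image, Set.mem_Iio,
      Set.mem_union, Set.mem_singleton_iff, Set.mem_ofPred_eq]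
    constructor
    · rintro ⟨_ | r, hr, rfl⟩
      · simp [ha0]
      · exact Or.inr ⟨⟨r, by omega⟩, rfl⟩
    · rintro (rfl | ⟨l, rfl⟩)
      · exact ⟨0, hp, by simp [ha0]⟩
      · exact ⟨l + 1, by omega, rfl⟩
end

section
/- The 2-step cyclic rational extension of the harmonic oscillator is an isotonic oscillator with integer angular momentum: let ω > 0, m ≥ 1, and let ψ_n(x) = e^{−ωx²/4}·H_n(√(ω/2)·x) denote the harmonic-oscillator eigenfunctions. Let W(x) be the Wronskian of ψ₁, ψ₃, …, ψ_{2m−1}. Then there exists a nonzero constant c such that W(x) = c · x^{m(m+1)/2} · e^{−mωx²/4} for all x ∈ ℝ, and consequently there exists a constant C ∈ ℝ such that for all x ≠ 0, (ω²x²/4 − ω/2) − 2·(d²/dx²)(log|W(x)|) = ω²x²/4 + m(m+1)/x² + C. -/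
/-- The physicists' Hermite polynomials:
`H₀ = 1`, `H₁ = 2x`, `H_{n+1} = 2x·H_n − 2n·H_{n-1}`. -/
noncomputable def hermiteH : ℕ → Polynomial ℝ
  | 0 => 1
  | 1 => Polynomial.C 2 * Polynomial.X
  | n + 2 => Polynomial.C 2 * Polynomial.X * hermiteH (n + 1)
      - Polynomial.C (2 * ((n : ℝ) + 1)) * hermiteH n

/-- The Wronskian of a list of functions: the determinant of the matrix whose
`(i, j)` entry is the `i`-th derivative of the `j`-th function (0-indexed);
the empty Wronskian is `1`. -/
noncomputable def wronskian (fs : List (ℝ → ℝ)) (z : ℝ) : ℝ :=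
  Matrix.det (Matrix.of fun i j : Fin fs.length => iteratedDeriv i.val (fs.get j) z)

/-- The harmonic-oscillator eigenfunction `ψ_n(x) = e^{−ωx²/4}·H_n(√(ω/2)·x)`. -/
noncomputable def hoEigen (ω : ℝ) (n : ℕ) : ℝ → ℝ := fun x =>
  Real.exp (-ω * x ^ 2 / 4) * (hermiteH n).eval (Real.sqrt (ω / 2) * x)

theorem wronskian_map_range (m : ℕ) (f : ℕ → ℝ → ℝ) (x : ℝ) :
    wronskian ((List.range m).map f) x =
      Matrix.det (Matrix.of fun i j : Fin m => iteratedDeriv i.val (f j) x) := by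
  have h : m = ((List.range m).map f).length := by simp
  rw [wronskian, ← Matrix.det_submatrix_equiv_self (finCongr h)]
  congr 1
  ext i j
  simp

/-- Multiplying every function by `g` multiplies the Wronskian by `g ^ m`. -/
theorem det_iteratedDeriv_mul {m : ℕ} {g : ℝ → ℝ} {f : Fin m → ℝ → ℝ}
    (hg : ContDiff ℝ (⊤ : ℕ∞) g) (hf : ∀ j, ContDiff ℝ (⊤ : ℕ∞) (f j)) (x : ℝ) :
    Matrix.det (Matrix.of fun i j : Fin m => iteratedDeriv i.val (fun y => g y * f j y) x) =
      g x ^ m * Matrix.det (Matrix.of fun i j : Fin m => iteratedDeriv i.val (f j) x) := by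
  set L : Matrix (Fin m) (Fin m) ℝ := Matrix.of fun i k =>
    (i.val.choose k.val : ℝ) * iteratedDeriv (i.val - k.val) g x with hL
  have hdet : L.det = g x ^ m := by
    rw [Matrix.det_of_isLowerTriangular]
    · simp [hL]
    · intro i k hik
      have : i.val < k.val := hik
      simp [hL, Nat.choose_eq_zero_of_lt this]
  rw [← hdet, ← Matrix.det_mul]
  congr 1
  ext i j
  rw [Matrix.mul_apply]
  simp only [Matrix.of_apply, hL]
  have hle : ((i.val : ℕ∞) : WithTop ℕ∞) ≤ ((⊤ : ℕ∞) : WithTop ℕ∞) := by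
    exact_mod_cast le_top
  have hcomm : (fun y => g y * f j y) = fun y => f j y * g y := by
    ext y; ring
  rw [hcomm, iteratedDeriv_fun_mul ((hf j).of_le hle).contDiffAt (hg.of_le hle).contDiffAt,
    Finset.sum_subset (Finset.range_subset_range.2 (Nat.succ_le_of_lt i.isLt)),
    Finset.sum_range]
  · exact Finset.sum_congr rfl fun k _ => by ring
  · intro k _ hk
    rw [Finset.mem_range, not_lt] at hk
    simp [Nat.choose_eq_zero_of_lt (show i.val < k by omega)]

theorem det_iteratedDeriv_linearCombination {m : ℕ} (A : Matrix (Fin m) (Fin m) ℝ)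
    {f : Fin m → ℝ → ℝ} (hf : ∀ j, ContDiff ℝ (⊤ : ℕ∞) (f j)) (x : ℝ) :
    Matrix.det (Matrix.of fun i j : Fin m =>
      iteratedDeriv i.val (fun y => ∑ k, A j k * f k y) x) =
      A.det * Matrix.det (Matrix.of fun i j : Fin m => iteratedDeriv i.val (f j) x) := by
  rw [← Matrix.det_transpose A, mul_comm, ← Matrix.det_mul]
  congr 1
  ext i j
  have hle : ((i.val : ℕ∞) : WithTop ℕ∞) ≤ ((⊤ : ℕ∞) : WithTop ℕ∞) := by
    exact_mod_cast le_top
  rw [Matrix.mul_apply, Matrix.of_apply, iteratedDeriv_fun_sum]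
  · exact Finset.sum_congr rfl fun k _ => by simp [mul_comm]
  · exact fun k _ => (contDiff_const.mul ((hf k).of_le hle)).contDiffAt

theorem det_descFactorial_odd_ne_zero (m : ℕ) :
    Matrix.det (Matrix.of fun i j : Fin m =>
      ((2 * i.val + 1).descFactorial j.val : ℝ)) ≠ 0 := by
  have h := Matrix.det_eval_matrixOfPolynomials_eq_det_vandermonde
    (fun i : Fin m => ((2 * i.val + 1 : ℕ) : ℝ)) (fun j => descPochhammer ℝ j)
    (fun j => descPochhammer_natDegree ℝ j) (fun j => monic_descPochhammer ℝ j)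
  simp only [descPochhammer_eval_eq_descFactorial] at h
  rw [← h, Matrix.det_vandermonde_ne_zero_iff]
  intro i j hij
  have : 2 * i.val + 1 = 2 * j.val + 1 := Nat.cast_injective (R := ℝ) hij
  exact Fin.ext (by omega)

/-- The Wronskian of `x, x³, …, x^(2m-1)` is a multiple of `x^(m(m+1)/2)`. -/
theorem det_iteratedDeriv_odd_pow {m : ℕ} (hm : 1 ≤ m) (x : ℝ) :
    Matrix.det (Matrix.of fun i j : Fin m =>
      iteratedDeriv i.val (fun y : ℝ => y ^ (2 * j.val + 1)) x) =
      Matrix.det (Matrix.of fun i j : Fin m =>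
        ((2 * i.val + 1).descFactorial j.val : ℝ)) * x ^ (m * (m + 1) / 2) := by
  rcases eq_or_ne x 0 with rfl | hx
  · have hpos : m * (m + 1) / 2 ≠ 0 := by
      have : 2 ≤ m * (m + 1) := by nlinarith
      omega
    rw [zero_pow hpos, mul_zero]
    exact Matrix.det_eq_zero_of_row_eq_zero ⟨0, hm⟩ fun j => by simp
  · have hexp : m * (m + 1) / 2 = ∑ i ∈ Finset.range m, (i + 1) := by
      have h := Finset.sum_range_id_mul_two (m + 1)
      rw [Finset.sum_range_succ', add_zero, Nat.add_sub_cancel] at h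
      rw [mul_comm m, ← h, Nat.mul_div_cancel _ two_pos]
    have hprod : x ^ (m * (m + 1) / 2) =
        (∏ j : Fin m, x⁻¹ ^ j.val) * ∏ j : Fin m, x ^ (2 * j.val + 1) := by
      rw [hexp, ← Finset.prod_pow_eq_pow_sum, Finset.prod_range, ← Finset.prod_mul_distrib]
      refine Finset.prod_congr rfl fun j _ => ?_
      rw [show 2 * j.val + 1 = j.val + (j.val + 1) by ring, pow_add x j.val (j.val + 1), ← mul_assoc,
        ← mul_pow, inv_mul_cancel₀ hx, one_pow, one_mul]
    rw [hprod, ← Matrix.det_transpose (Matrix.of fun i j : Fin m =>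
      ((2 * i.val + 1).descFactorial j.val : ℝ)), mul_comm, mul_assoc,
      ← Matrix.det_mul_row, ← Matrix.det_mul_column]
    congr 1
    ext i j
    simp only [Matrix.of_apply, Matrix.transpose_apply, iteratedDeriv_pow]
    rcases lt_or_ge (2 * j.val + 1) i.val with h | h
    · simp [Nat.descFactorial_of_lt h]
    · rw [pow_sub₀ x hx h, inv_pow]
      ring

theorem hermiteH_coeff_of_lt : ∀ {n k : ℕ}, n < k → (hermiteH n).coeff k = 0
  | 0, k + 1, _ => by simp [hermiteH, Polynomial.coeff_one]
  | 1, k + 1, h => by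
    rw [hermiteH, Polynomial.coeff_C_mul, Polynomial.coeff_X_of_ne_one (by omega), mul_zero]
  | n + 2, k + 1, h => by
    rw [hermiteH, Polynomial.coeff_sub, mul_assoc, Polynomial.coeff_C_mul, Polynomial.coeff_C_mul,
      Polynomial.coeff_X_mul, hermiteH_coeff_of_lt (by omega), hermiteH_coeff_of_lt (by omega)]
    simp

theorem hermiteH_coeff_self : ∀ n : ℕ, (hermiteH n).coeff n = 2 ^ n
  | 0 => by simp [hermiteH]
  | 1 => by simp [hermiteH]
  | n + 2 => by
    rw [hermiteH, Polynomial.coeff_sub, mul_assoc, Polynomial.coeff_C_mul, Polynomial.coeff_C_mul,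
      Polynomial.coeff_X_mul, hermiteH_coeff_self, hermiteH_coeff_of_lt (by omega)]
    ring

theorem hermiteH_coeff_of_odd_add : ∀ {n k : ℕ}, Odd (n + k) → (hermiteH n).coeff k = 0
  | 0, k, h => by
    have : k ≠ 0 := by rintro rfl; simp at h
    simp [hermiteH, Polynomial.coeff_one, this]
  | 1, k, h => by
    have : k ≠ 1 := by rintro rfl; exact absurd h (by decide)
    rw [hermiteH, Polynomial.coeff_C_mul, Polynomial.coeff_X_of_ne_one this, mul_zero]
  | n + 2, k, h => by
    have h2 : (hermiteH n).coeff k = 0 := hermiteH_coeff_of_odd_add (by grind)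
    rw [hermiteH, Polynomial.coeff_sub, mul_assoc, Polynomial.coeff_C_mul, Polynomial.coeff_C_mul,
      h2]
    cases k with
    | zero => simp
    | succ k =>
      rw [Polynomial.coeff_X_mul, hermiteH_coeff_of_odd_add (by grind)]
      simp

theorem hermiteH_odd_eval {m j : ℕ} (hj : j < m) (y : ℝ) :
    (hermiteH (2 * j + 1)).eval y =
      ∑ k ∈ Finset.range m, (hermiteH (2 * j + 1)).coeff (2 * k + 1) * y ^ (2 * k + 1) := by
  have hdeg : (hermiteH (2 * j + 1)).natDegree < 2 * m :=
    (Polynomial.natDegree_le_iff_coeff_eq_zero.2 fun _ h => hermiteH_coeff_of_lt h).trans_lt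
      (by omega)
  rw [Polynomial.eval_eq_sum_range' hdeg]
  clear hdeg hj
  induction m with
  | zero => simp
  | succ m ih =>
    rw [show 2 * (m + 1) = 2 * m + 1 + 1 by ring, Finset.sum_range_succ, Finset.sum_range_succ, ih,
      Finset.sum_range_succ, hermiteH_coeff_of_odd_add (k := 2 * m) (by grind)]
    ring

theorem wronskian_odd_hoEigen {ω : ℝ} (hω : 0 < ω) {m : ℕ} (hm : 1 ≤ m) :
    ∃ c : ℝ, c ≠ 0 ∧ ∀ x : ℝ,
      wronskian ((List.range m).map fun i => hoEigen ω (2 * i + 1)) x =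
        c * x ^ (m * (m + 1) / 2) * Real.exp (-(m : ℝ) * ω * x ^ 2 / 4) := by
  set s : ℝ := Real.sqrt (ω / 2) with hs
  have hspos : 0 < s := Real.sqrt_pos.2 (by positivity)
  set A : Matrix (Fin m) (Fin m) ℝ := Matrix.of fun j k =>
    (hermiteH (2 * j.val + 1)).coeff (2 * k.val + 1) * s ^ (2 * k.val + 1) with hA
  have hAdet : A.det ≠ 0 := by
    rw [Matrix.det_of_isLowerTriangular]
    · refine Finset.prod_ne_zero_iff.2 fun i _ => ?_
      simp only [hA, Matrix.of_apply, hermiteH_coeff_self]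
      positivity
    · intro i k hik
      have : i.val < k.val := hik
      simp only [hA, Matrix.of_apply]
      rw [hermiteH_coeff_of_lt (by omega), zero_mul]
  refine ⟨A.det * _, mul_ne_zero hAdet (det_descFactorial_odd_ne_zero m), fun x => ?_⟩
  have hfun : ∀ j : Fin m, hoEigen ω (2 * j.val + 1) = fun y =>
      Real.exp (-ω * y ^ 2 / 4) * ∑ k : Fin m, A j k * y ^ (2 * k.val + 1) := by
    intro j
    ext y
    rw [hoEigen, hermiteH_odd_eval j.isLt, Finset.sum_range]
    simp only [hA, Matrix.of_apply, mul_pow, mul_assoc, ← hs]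
  rw [wronskian_map_range]
  simp only [hfun]
  rw [det_iteratedDeriv_mul (by fun_prop) (fun j => by fun_prop),
    det_iteratedDeriv_linearCombination A (fun j => by fun_prop), det_iteratedDeriv_odd_pow hm,
    ← Real.exp_nat_mul]
  rw [show (m : ℝ) * (-ω * x ^ 2 / 4) = -(m : ℝ) * ω * x ^ 2 / 4 by ring]
  ring

theorem deriv_deriv_log_abs_gaussian_monomial {c : ℝ} (hc : c ≠ 0) (N : ℕ) (b : ℝ) {x : ℝ}
    (hx : x ≠ 0) :
    deriv (deriv fun u : ℝ => Real.log |c * u ^ N * Real.exp (b * u ^ 2)|) x =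
      -N / x ^ 2 + 2 * b := by
  have hlog : ∀ u : ℝ, u ≠ 0 → HasDerivAt
      (fun u : ℝ => Real.log |c * u ^ N * Real.exp (b * u ^ 2)|) (N * u⁻¹ + 2 * b * u) u := by
    intro u hu
    have h : HasDerivAt (fun u : ℝ => Real.log c + N * Real.log u + b * u ^ 2)
        (N * u⁻¹ + 2 * b * u) u := by
      refine ((((Real.hasDerivAt_log hu).const_mul (N : ℝ)).const_add (Real.log c)).add
        ((hasDerivAt_pow 2 u).const_mul b)).congr_deriv ?_
      push_cast
      ring
    refine h.congr_of_eventuallyEq ?_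
    filter_upwards [isOpen_ne.mem_nhds hu] with v hv
    have hv : v ≠ 0 := hv
    rw [Real.log_abs, Real.log_mul (mul_ne_zero hc (pow_ne_zero _ hv)) (Real.exp_ne_zero _),
      Real.log_mul hc (pow_ne_zero _ hv), Real.log_pow, Real.log_exp]
  have h2 : HasDerivAt (fun u : ℝ => N * u⁻¹ + 2 * b * u) (-N / x ^ 2 + 2 * b) x := by
    refine (((hasDerivAt_inv hx).const_mul (N : ℝ)).add
      ((hasDerivAt_id x).const_mul (2 * b))).congr_deriv ?_
    ring
  refine (h2.congr_of_eventuallyEq ?_).deriv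
  filter_upwards [isOpen_ne.mem_nhds hx] with u hu using (hlog u hu).deriv

/-- for `ω > 0` and `m ≥ 1`, the Wronskian `W` of the odd
harmonic-oscillator eigenfunctions `ψ₁, ψ₃, …, ψ_{2m−1}` satisfies
`W(x) = c·x^{m(m+1)/2}·e^{−mωx²/4}` for some nonzero constant `c`, and consequently
the 2-step cyclic rational extension
`(ω²x²/4 − ω/2) − 2·(log|W|)″` equals `ω²x²/4 + m(m+1)/x² + C` for some constant `C`
on `ℝ \ {0}`: it is an isotonic oscillator with integer angular momentum. -/
theorem two_cyclic_extension_is_isotonic (ω : ℝ) (hω : 0 < ω) (m : ℕ) (hm : 1 ≤ m)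
    (W : ℝ → ℝ)
    (hW : W = fun x => wronskian ((List.range m).map fun i => hoEigen ω (2 * i + 1)) x) :
    (∃ c : ℝ, c ≠ 0 ∧ ∀ x : ℝ,
        W x = c * x ^ (m * (m + 1) / 2) * Real.exp (-(m : ℝ) * ω * x ^ 2 / 4)) ∧
    ∃ C : ℝ, ∀ x : ℝ, x ≠ 0 →
      (ω ^ 2 * x ^ 2 / 4 - ω / 2)
          - 2 * deriv (deriv (fun u => Real.log |W u|)) x
        = ω ^ 2 * x ^ 2 / 4 + (m : ℝ) * ((m : ℝ) + 1) / x ^ 2 + C := by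
  subst hW
  obtain ⟨c, hc, hW⟩ := wronskian_odd_hoEigen hω hm
  refine ⟨⟨c, hc, hW⟩, m * ω - ω / 2, fun x hx => ?_⟩
  have hcast : 2 * ((m * (m + 1) / 2 : ℕ) : ℝ) = m * (m + 1) := by
    exact_mod_cast Nat.mul_div_cancel' (Nat.even_mul_succ_self m).two_dvd
  have hW' : ∀ u, wronskian ((List.range m).map fun i => hoEigen ω (2 * i + 1)) u =
      c * u ^ (m * (m + 1) / 2) * Real.exp (-(m * ω / 4) * u ^ 2) := by
    intro u
    rw [hW, show -(m : ℝ) * ω * u ^ 2 / 4 = -(m * ω / 4) * u ^ 2 by ring]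
  simp only [hW']
  rw [deriv_deriv_log_abs_gaussian_monomial hc _ _ hx, ← hcast]
  ring
end
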